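/- There exists a real constant c > 0 such that the constant coefficient of the minimal polynomial of h over E equals −c times the element P²·Q of E; that is, (minpoly E h).coeff 0 = −c • (P²Q viewed as an element of E). -/

import Mathlib

noncomputable section

abbrev R2 : Type := MvPolynomial (Fin 2) ℝ

def x : R2 := MvPolynomial.X 0
def y : R2 := MvPolynomial.X 1
def t : R2 := x * y - 1
def h : R2 := t * (x * t + 1)
def f : R2 := (x * t + 1) ^ 2 * (t ^ 2 + y)
def P : R2 := f + h
def q : R2 := -t ^ 2 - 6 * t * h * (h + 1)
def u : R2 :=
  170 * f * h + 91 * h ^ 2 + 195 * f * h ^ 2 + 69 * h ^ 3 + 75 * f * h ^ 3 + MvPolynomial.C (75 / 4 : ℝ) * h ^ 4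
def Q : R2 := q - u

abbrev K : Type := FractionRing (MvPolynomial (Fin 2) ℝ)

/-- The canonical image of a polynomial in the rational function field `K = ℝ(x,y)`. -/
def ι : R2 →+* K := algebraMap R2 K

/-- The images of `P`, `Q`, `h` in the rational function field `K`. -/
def PK : K := ι P
def QK : K := ι Q
def hK : K := ι h

/-- `E = ℝ(P,Q)`, the intermediate field of `K` over `ℝ` generated by `P` and `Q`. -/
def E : IntermediateField ℝ K := IntermediateField.adjoin ℝ ({PK, QK} : Set K)

open Polynomial in
/-- Clearing denominators in the expression of `Q` as a rational function of `P` and `h` yields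
this polynomial in `h`, with coefficients in `ℤ[P, Q]`. -/
def hPoly {R : Type*} [CommRing R] (p q : R) : R[X] :=
  (C p - X) ^ 2 * (4 * C q + (680 * (C p - X) * X + 364 * X ^ 2 + 780 * (C p - X) * X ^ 2
    + 276 * X ^ 3 + 300 * (C p - X) * X ^ 3 + 75 * X ^ 4))
  + (4 * X ^ 2 * (C p - 2 * X - X ^ 2) ^ 2
    + 24 * X ^ 2 * (C p - 2 * X - X ^ 2) * (X + 1) * (C p - X))

section hPoly

open Polynomial

variable {R : Type*} [CommRing R]

theorem hPoly_map {S : Type*} [CommRing S] (φ : R →+* S) (p q : R) :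
    (hPoly p q).map φ = hPoly (φ p) (φ q) := by
  simp [hPoly]

theorem hPoly_coeff_zero (p q : R) : (hPoly p q).coeff 0 = 4 * p ^ 2 * q := by
  simp [hPoly, coeff_zero_eq_eval_zero]
  ring

theorem hPoly_natDegree [Nontrivial R] (h197 : (197 : R) ≠ 0) (p q : R) :
    (hPoly p q).natDegree = 6 := by
  unfold hPoly
  compute_degree!

theorem hPoly_coeff_six [Nontrivial R] (p q : R) :
    (hPoly p q).coeff 6 = -197 := by
  unfold hPoly
  compute_degree!

theorem irreducible_hPoly_generic {B : Type*} [CommRing B] [IsDomain B]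
    [UniqueFactorizationMonoid B] {p : B}
    (h4 : IsUnit (4 : B)) (hp : p ≠ 0) (hp' : p + 1 ≠ 0) : Irreducible (hPoly (C p) (X : B[X])) := by
  set b : B[X] := hPoly p 0 with hb
  have key : hPoly (C p) (X : B[X]) = Bivariate.swap (C (4 * (X - C p) ^ 2) * X + C b) := by
    simp [hPoly, hb, Bivariate.swap_apply]
    ring
  rw [key, MulEquiv.irreducible_iff]
  refine irreducible_C_mul_X_add_C ?_ ?_
  · have h4' : (4 : B[X]) ≠ 0 := by
      rw [← map_ofNat (C : B →+* B[X])]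
      exact C_ne_zero.2 h4.ne_zero
    exact mul_ne_zero h4' (pow_ne_zero _ (X_sub_C_ne_zero p))
  · have h4' : IsUnit (4 : B[X]) := by
      rw [← map_ofNat (C : B →+* B[X])]
      exact h4.map C
    rw [isRelPrime_mul_unit_left_left h4']
    refine IsRelPrime.pow_left ?_
    rw [(irreducible_X_sub_C p).isRelPrime_iff_not_dvd, dvd_iff_isRoot, IsRoot.def]
    have : eval p b = 4 * (p ^ 2 * (p + 1)) ^ 2 := by
      simp [hb, hPoly]
      ring
    rw [this]
    exact mul_ne_zero h4.ne_zero (pow_ne_zero _ (mul_ne_zero (pow_ne_zero _ hp) hp'))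

theorem irreducible_hPoly_algebraMap {B E : Type*} [CommRing B] [IsDomain B]
    [UniqueFactorizationMonoid B] [Field E] [Algebra B[X] E] [IsFractionRing B[X] E] {p : B}
    (h4 : IsUnit (4 : B)) (h197 : (197 : B) ≠ 0) (hp : p ≠ 0) (hp' : p + 1 ≠ 0) :
    Irreducible (hPoly (algebraMap B[X] E (C p)) (algebraMap B[X] E X)) := by
  have hirr := irreducible_hPoly_generic h4 hp hp'
  rw [← hPoly_map, ← IsPrimitive.irreducible_iff_irreducible_map_fraction_map]
  · exact hirr
  · refine hirr.isPrimitive ?_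
    rw [hPoly_natDegree]
    · simp
    · rw [← map_ofNat (C : B →+* B[X])]
      exact C_ne_zero.2 h197

end hPoly

/-- `hPoly p q` is irreducible over `k(p, q)` when `p` and `q` are algebraically independent. -/
theorem irreducible_hPoly {k L : Type*} [Field k] [CharZero k] [Field L] [Algebra k L] {v : Fin 2 → L}
    (hv : AlgebraicIndependent k v) {q p : IntermediateField.adjoin k (Set.range v)}
    (hq : (q : L) = v 0) (hp : (p : L) = v 1) :
    Irreducible (hPoly p q) := by
  let φ : MvPolynomial (Fin 2) k →ₐ[k] IntermediateField.adjoin k (Set.range v) :=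
    MvPolynomial.aeval ![q, p]
  have hφ (g : MvPolynomial (Fin 2) k) : (φ g : L) = MvPolynomial.aeval v g := by
    have : (IntermediateField.val _).comp φ = MvPolynomial.aeval v := by
      ext i
      fin_cases i <;> simp [φ, hq, hp]
    exact DFunLike.congr_fun this g
  let e := MvPolynomial.finSuccEquiv k 1
  let θ : Polynomial (MvPolynomial (Fin 1) k) →+* IntermediateField.adjoin k (Set.range v) :=
    φ.toRingHom.comp e.symm.toAlgHom.toRingHom
  let _ := θ.toAlgebra
  have hθ (g : MvPolynomial (Fin 2) k) :
      algebraMap (Polynomial (MvPolynomial (Fin 1) k)) _ (e g) = φ g := by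
    simp [RingHom.algebraMap_toAlgebra, θ]
  have : FaithfulSMul (Polynomial (MvPolynomial (Fin 1) k))
      (IntermediateField.adjoin k (Set.range v)) := by
    rw [faithfulSMul_iff_algebraMap_injective, RingHom.algebraMap_toAlgebra]
    refine Function.Injective.comp (g := φ) ?_ e.symm.injective
    intro a b hab
    apply hv
    rw [← hφ, ← hφ, hab]
  have : IsFractionRing (Polynomial (MvPolynomial (Fin 1) k))
      (IntermediateField.adjoin k (Set.range v)) := by
    refine .of_field _ _ fun z ↦ ?_
    obtain ⟨r, s, hrs⟩ := (IntermediateField.mem_adjoin_range_iff k v (z : L)).1 z.2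
    refine ⟨e r, e s, ?_⟩
    rw [hθ, hθ]
    apply Subtype.ext
    simp [hφ, hrs]
  have h4 : IsUnit (4 : MvPolynomial (Fin 1) k) := by
    rw [← map_ofNat (MvPolynomial.C (R := k))]
    exact (IsUnit.mk0 (4 : k) (by norm_num)).map MvPolynomial.C
  have hp' : (MvPolynomial.X 0 : MvPolynomial (Fin 1) k) + 1 ≠ 0 := fun H ↦ by
    simpa using congrArg (MvPolynomial.eval 0) H
  have := irreducible_hPoly_algebraMap (E := IntermediateField.adjoin k (Set.range v)) h4
    (by norm_num) (MvPolynomial.X_ne_zero 0) hp'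
  rw [← MvPolynomial.finSuccEquiv_X_succ (n := 1), ← MvPolynomial.finSuccEquiv_X_zero] at this
  change Irreducible (hPoly (algebraMap _ _ (e _)) (algebraMap _ _ (e _))) at this
  rw [hθ, hθ] at this
  simpa [φ] using this

theorem t_ne_zero : t ≠ 0 := fun H ↦ by
  simpa [t, x, y] using congrArg (MvPolynomial.eval 0) H

theorem x_ne_zero : x ≠ 0 := MvPolynomial.X_ne_zero 0

theorem f_ne_zero : f ≠ 0 := fun H ↦ by
  have := congrArg (MvPolynomial.eval ![0, 1]) H
  norm_num [f, t, x, y] at this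

theorem f_mul_t : f * t = h * (P - 2 * h - h ^ 2) := by
  simp only [P, f, h, t]
  ring

theorem t_sq_mul_x : t ^ 2 * x = h - t := by
  simp only [h]
  ring

theorem h_sub_t_mul_y : (h - t) * y = t ^ 2 * (t + 1) := by
  simp only [h, t]
  ring

open Polynomial in
theorem hPoly_eval_h : eval h (hPoly P Q) = 0 := by
  have hc : (4 : R2) * MvPolynomial.C (75 / 4 : ℝ) = 75 := by
    rw [← map_ofNat (MvPolynomial.C : ℝ →+* R2) 4, ← map_mul,
      ← map_ofNat (MvPolynomial.C : ℝ →+* R2) 75]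
    norm_num
  have hu : 4 * u = 680 * f * h + 364 * h ^ 2 + 780 * f * h ^ 2 + 276 * h ^ 3
      + 300 * f * h ^ 3 + 75 * h ^ 4 := by
    unfold u
    linear_combination h ^ 4 * hc
  have hf : P - h = f := by simp [P]
  simp only [hPoly, eval_add, eval_mul, eval_sub, eval_pow, eval_C, eval_X, eval_ofNat, eval_one,
    hf]
  have hQ : Q = -t ^ 2 - 6 * t * h * (h + 1) - u := rfl
  rw [hQ]
  linear_combination -f ^ 2 * hu
    - (4 * (f * t + h * (P - 2 * h - h ^ 2)) + 24 * h * (h + 1) * f) * f_mul_t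

theorem PK_mem : PK ∈ E := IntermediateField.subset_adjoin _ _ (by simp)

theorem QK_mem : QK ∈ E := IntermediateField.subset_adjoin _ _ (by simp)

open Polynomial in
theorem aeval_hK_hPoly : aeval hK (hPoly (⟨PK, PK_mem⟩ : E) ⟨QK, QK_mem⟩) = 0 := by
  have : (hPoly P Q).map ι = (hPoly (⟨PK, PK_mem⟩ : E) ⟨QK, QK_mem⟩).map (algebraMap E K) := by
    rw [hPoly_map, hPoly_map]
    rfl
  rw [← eval_map_algebraMap, ← this, hK, eval_map_apply, hPoly_eval_h, map_zero]

open Polynomial in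
theorem isIntegral_hK : IsIntegral E hK := by
  refine IsAlgebraic.isIntegral ⟨_, fun H ↦ ?_, aeval_hK_hPoly⟩
  have := congrArg natDegree H
  rw [hPoly_natDegree (by norm_num)] at this
  simp at this

theorem ι_injective : Function.Injective ι := IsFractionRing.injective R2 K

open IntermediateField in
theorem E_adjoin_hK_eq_top : E⟮hK⟯ = ⊤ := by
  have hh : ι h ∈ E⟮hK⟯ := mem_adjoin_simple_self _ _
  have hP : ι P ∈ E⟮hK⟯ := E⟮hK⟯.algebraMap_mem ⟨PK, PK_mem⟩
  have hf0 : ι f ≠ 0 := (map_ne_zero_iff ι ι_injective).2 f_ne_zero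
  have ht0 : ι t ≠ 0 := (map_ne_zero_iff ι ι_injective).2 t_ne_zero
  have hx0 : ι x ≠ 0 := (map_ne_zero_iff ι ι_injective).2 x_ne_zero
  have hf : ι f ∈ E⟮hK⟯ := by
    have : ι f = ι P - ι h := by simp [P]
    rw [this]
    exact sub_mem hP hh
  have ht : ι t ∈ E⟮hK⟯ := by
    have := congrArg ι f_mul_t
    simp only [map_mul, map_sub, map_pow, map_ofNat] at this
    rw [eq_div_of_mul_eq hf0 ((mul_comm _ _).trans this)]
    exact div_mem (mul_mem hh (sub_mem (sub_mem hP (mul_mem (ofNat_mem _ 2) hh)) (pow_mem hh 2))) hf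
  have key := congrArg ι t_sq_mul_x
  simp only [map_mul, map_sub, map_pow] at key
  have hx : ι x ∈ E⟮hK⟯ := by
    rw [eq_div_of_mul_eq (pow_ne_zero 2 ht0) ((mul_comm _ _).trans key)]
    exact div_mem (sub_mem hh ht) (pow_mem ht 2)
  have hy : ι y ∈ E⟮hK⟯ := by
    have := congrArg ι h_sub_t_mul_y
    simp only [map_mul, map_sub, map_pow, map_add, map_one] at this
    have h0 : ι h - ι t ≠ 0 := key ▸ mul_ne_zero (pow_ne_zero 2 ht0) hx0
    rw [eq_div_of_mul_eq h0 ((mul_comm _ _).trans this)]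
    exact div_mem (mul_mem (pow_mem ht 2) (add_mem ht (one_mem _))) (sub_mem hh ht)
  have hι (g : R2) : ι g ∈ E⟮hK⟯ := by
    induction g using MvPolynomial.induction_on with
    | C a =>
      have : ι (MvPolynomial.C a) = algebraMap E K (algebraMap ℝ E a) := rfl
      rw [this]
      exact E⟮hK⟯.algebraMap_mem _
    | add p q hp hq => exact map_add ι p q ▸ add_mem hp hq
    | mul_X p i hp =>
      rw [map_mul]
      refine mul_mem hp ?_
      fin_cases i
      exacts [hx, hy]
  rw [eq_top_iff]
  rintro z -
  obtain ⟨a, b, -, rfl⟩ := IsFractionRing.div_surjective (A := R2) z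
  exact div_mem (hι a) (hι b)

open IntermediateField in
theorem algebraicIndependent_QK_PK : AlgebraicIndependent ℝ ![QK, PK] := by
  have hrange : Set.range ![QK, PK] = {PK, QK} := by
    simp [Set.pair_comm]
  have : Algebra.IsAlgebraic E K := by
    have := isAlgebraic_adjoin_simple isIntegral_hK
    rw [E_adjoin_hK_eq_top] at this
    exact topEquiv.isAlgebraic
  have : Algebra.IsAlgebraic (Algebra.adjoin ℝ (Set.range ![QK, PK])) K := by
    rw [hrange]
    exact isAlgebraic_adjoin_iff_top.1 this
  refine (Algebra.IsAlgebraic.isTranscendenceBasis_of_lift_le_trdeg_of_finite ℝ _ ?_).1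
  have := trdeg_le_of_injective (IsScalarTower.toAlgHom ℝ R2 K) ι_injective
  rw [MvPolynomial.trdeg_of_isDomain] at this
  simpa using this

theorem irreducible_hPoly_PK_QK : Irreducible (hPoly (⟨PK, PK_mem⟩ : E) ⟨QK, QK_mem⟩) := by
  have key (F : IntermediateField ℝ K) (hF : F = IntermediateField.adjoin ℝ (Set.range ![QK, PK]))
      (hP : PK ∈ F) (hQ : QK ∈ F) : Irreducible (hPoly (⟨PK, hP⟩ : F) ⟨QK, hQ⟩) := by
    subst hF
    exact irreducible_hPoly algebraicIndependent_QK_PK rfl rfl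
  refine key E ?_ _ _
  simp [E, Set.pair_comm]

/-- The constant coefficient of the minimal polynomial of `h` over `E` is a negative
constant multiple of `P²Q`. -/
theorem pinchuk_minpoly_constant_coeff :
    ∃ c : ℝ, 0 < c ∧ ∃ hmem : PK ^ 2 * QK ∈ E,
      (minpoly E hK).coeff 0 = -c • (⟨PK ^ 2 * QK, hmem⟩ : E) := by
  refine ⟨4 / 197, by norm_num, mul_mem (pow_mem PK_mem 2) QK_mem, ?_⟩
  rw [← minpoly.eq_of_irreducible irreducible_hPoly_PK_QK aeval_hK_hPoly,
    Polynomial.leadingCoeff, hPoly_natDegree (by norm_num), hPoly_coeff_six,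
    Polynomial.coeff_mul_C, hPoly_coeff_zero, Algebra.smul_def]
  have : algebraMap ℝ E (-(4 / 197)) = 4 * (-197)⁻¹ := by
    rw [← map_ofNat (algebraMap ℝ E) 4, ← map_ofNat (algebraMap ℝ E) 197, ← map_neg, ← map_inv₀,
      ← map_mul]
    norm_num
  rw [this]
  have : (⟨PK ^ 2 * QK, mul_mem (pow_mem PK_mem 2) QK_mem⟩ : E)
      = ⟨PK, PK_mem⟩ ^ 2 * ⟨QK, QK_mem⟩ := rfl
  rw [this]
  ring
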